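/- Let ρ and σ be N×N positive semidefinite complex matrices and δ ≥ 0, and set r₁ = rank_δ(ρ) and r₂ = rank_δ(σ). Then w(ρ − σ, δ) ≤ r₁δ + r₂δ + w(ρ, δ) + w(σ, δ). -/

import Mathlib

open Finset ComplexOrder

/-- The approximate rank of a Hermitian matrix with respect to `δ`:
the number of eigenvalues (with multiplicity) of absolute value greater than `δ`. -/
noncomputable def hermRank {N : ℕ} {A : Matrix (Fin N) (Fin N) ℂ}
    (hA : A.IsHermitian) (δ : ℝ) : ℕ :=
  (Finset.univ.filter (fun j => δ < |hA.eigenvalues j|)).card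

/-- The sum of the absolute values of the eigenvalues of a Hermitian matrix
that are at most `δ` in absolute value. -/
noncomputable def hermW {N : ℕ} {A : Matrix (Fin N) (Fin N) ℂ}
    (hA : A.IsHermitian) (δ : ℝ) : ℝ :=
  ∑ j ∈ Finset.univ.filter (fun j => |hA.eigenvalues j| ≤ δ), |hA.eigenvalues j|

/-- If the quadratic form diagonal in `v` with weights `a` is dominated by the one diagonal in `u`
with weights `b`, then `b` has at least as many weights above any threshold as `a`. -/
lemma card_filter_lt_le_of_sum_mul_norm_inner_le {ι E : Type*} [Fintype ι] [NormedAddCommGroup E]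
    [InnerProductSpace ℂ E] (v u : OrthonormalBasis ι ℂ E) (a b : ι → ℝ)
    (h : ∀ x : E, ∑ j, a j * ‖inner ℂ (v j) x‖ ^ 2 ≤ ∑ j, b j * ‖inner ℂ (u j) x‖ ^ 2) (t : ℝ) :
    #{j | t < a j} ≤ #{j | t < b j} := by
  classical
  have : FiniteDimensional ℂ E := v.toBasis.finiteDimensional_of_finite
  by_contra! hlt
  let L : E →ₗ[ℂ] ({j // ¬ t < a j} → ℂ) × ({j // t < b j} → ℂ) :=
    (LinearMap.pi fun j => (innerSL ℂ (v j.1)).toLinearMap).prod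
      (LinearMap.pi fun j => (innerSL ℂ (u j.1)).toLinearMap)
  have hker : LinearMap.ker L ≠ ⊥ := by
    apply LinearMap.ker_ne_bot_of_finrank_lt
    rw [Module.finrank_prod, Module.finrank_fintype_fun_eq_card, Module.finrank_fintype_fun_eq_card,
      Module.finrank_eq_card_basis v.toBasis, Fintype.card_subtype, Fintype.card_subtype]
    have := Finset.card_filter_add_card_filter_not (s := (univ : Finset ι)) (fun j => t < a j)
    rw [Finset.card_univ] at this
    omega
  obtain ⟨x, hx, hx0⟩ := (Submodule.ne_bot_iff _).1 hker
  have hL : L x = 0 := hx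
  have hv : ∀ j, ¬ t < a j → inner ℂ (v j) x = 0 := fun j hj =>
    congrFun (congrArg Prod.fst hL) ⟨j, hj⟩
  have hu : ∀ j, t < b j → inner ℂ (u j) x = 0 := fun j hj =>
    congrFun (congrArg Prod.snd hL) ⟨j, hj⟩
  have hb : ∑ j, b j * ‖inner ℂ (u j) x‖ ^ 2 ≤ t * ‖x‖ ^ 2 := by
    rw [← u.sum_sq_norm_inner_right x, Finset.mul_sum]
    refine Finset.sum_le_sum fun j _ => ?_
    by_cases hj : t < b j
    · simp [hu j hj]
    · exact mul_le_mul_of_nonneg_right (not_lt.1 hj) (by positivity)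
  have ha : t * ‖x‖ ^ 2 < ∑ j, a j * ‖inner ℂ (v j) x‖ ^ 2 := by
    have hpos : 0 < ∑ j, ‖inner ℂ (v j) x‖ ^ 2 := by
      rw [v.sum_sq_norm_inner_right x]
      positivity
    obtain ⟨k, -, hk⟩ := Finset.exists_lt_of_sum_lt (s := univ) (f := fun _ : ι => (0 : ℝ))
      (by simpa using hpos)
    rw [← v.sum_sq_norm_inner_right x, Finset.mul_sum]
    refine Finset.sum_lt_sum (fun j _ => ?_) ⟨k, mem_univ k, ?_⟩
    · by_cases hj : t < a j
      · exact mul_le_mul_of_nonneg_right hj.le (by positivity)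
      · simp [hv j hj]
    · refine mul_lt_mul_of_pos_right ?_ hk
      by_contra hj
      simp [hv k hj] at hk
  exact absurd (h x) (not_le.2 (hb.trans_lt ha))

lemma setIntegral_Ico_indicator_Iio (x δ : ℝ) :
    ∫ t in Set.Ico 0 δ, (Set.Iio x).indicator (1 : ℝ → ℝ) t = max (min δ x) 0 := by
  rw [MeasureTheory.integral_indicator_one measurableSet_Iio,
    MeasureTheory.measureReal_restrict_apply measurableSet_Iio, Set.inter_comm,
    Set.Ico_inter_Iio, Real.volume_real_Ico, sub_zero]

lemma sum_max_min_le_of_card_filter_lt_le {ι : Type*} [Fintype ι] (a b : ι → ℝ)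
    (h : ∀ t : ℝ, #{j | t < a j} ≤ #{j | t < b j}) (δ : ℝ) :
    ∑ j, max (min δ (a j)) 0 ≤ ∑ j, max (min δ (b j)) 0 := by
  have hint : ∀ x : ℝ, MeasureTheory.IntegrableOn
      ((Set.Iio x).indicator (1 : ℝ → ℝ)) (Set.Ico 0 δ) := fun x =>
    MeasureTheory.Integrable.indicator (MeasureTheory.integrable_const (1 : ℝ)) measurableSet_Iio
  have hcard : ∀ (c : ι → ℝ) (t : ℝ),
      ∑ j, (Set.Iio (c j)).indicator (1 : ℝ → ℝ) t = (#{j | t < c j} : ℝ) := fun c t => by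
    simp [Set.indicator_apply, Finset.sum_boole]
  simp only [← setIntegral_Ico_indicator_Iio]
  rw [← MeasureTheory.integral_finsetSum _ fun j _ => hint (a j),
    ← MeasureTheory.integral_finsetSum _ fun j _ => hint (b j)]
  refine MeasureTheory.integral_mono (MeasureTheory.integrable_finsetSum _ fun j _ => hint (a j))
    (MeasureTheory.integrable_finsetSum _ fun j _ => hint (b j)) fun t => ?_
  simp only [hcard]
  exact_mod_cast h t

lemma Matrix.IsHermitian.re_inner_toEuclideanLin_eq_sum {n : Type*} [Fintype n] [DecidableEq n]
    {A : Matrix n n ℂ} (hA : A.IsHermitian) (x : EuclideanSpace ℂ n) :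
    (inner ℂ x (A.toEuclideanLin x)).re =
      ∑ j, hA.eigenvalues j * ‖inner ℂ (hA.eigenvectorBasis j) x‖ ^ 2 := by
  have hsymm := Matrix.isSymmetric_toEuclideanLin_iff.2 hA
  have heig : ∀ j, A.toEuclideanLin (hA.eigenvectorBasis j) =
      (hA.eigenvalues j : ℂ) • hA.eigenvectorBasis j := fun j => by
    ext i
    simpa using congrFun (hA.mulVec_eigenvectorBasis j) i
  rw [← hA.eigenvectorBasis.sum_inner_mul_inner, Complex.re_sum]
  refine Finset.sum_congr rfl fun j _ => ?_
  rw [← hsymm, heig, inner_smul_left, ← inner_conj_symm x, mul_left_comm, Complex.conj_mul']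
  simp [← Complex.ofReal_pow]

lemma Matrix.PosSemidef.re_inner_toEuclideanLin_nonneg {n : Type*} [Fintype n] [DecidableEq n]
    {A : Matrix n n ℂ} (hA : A.PosSemidef) (x : EuclideanSpace ℂ n) :
    0 ≤ (inner ℂ x (A.toEuclideanLin x)).re := by
  rw [hA.isHermitian.re_inner_toEuclideanLin_eq_sum]
  exact Finset.sum_nonneg fun j _ => mul_nonneg (hA.eigenvalues_nonneg j) (by positivity)

lemma sum_max_min_eigenvalues_eq {N : ℕ} {A : Matrix (Fin N) (Fin N) ℂ} (hA : A.PosSemidef)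
    {δ : ℝ} (hδ : 0 ≤ δ) :
    ∑ j, max (min δ (hA.isHermitian.eigenvalues j)) 0 =
      (hermRank hA.isHermitian δ : ℝ) * δ + hermW hA.isHermitian δ := by
  rw [hermRank, hermW, ← nsmul_eq_mul, ← Finset.sum_const, Finset.sum_filter, Finset.sum_filter,
    ← Finset.sum_add_distrib]
  refine Finset.sum_congr rfl fun j _ => ?_
  have := hA.eigenvalues_nonneg j
  rw [abs_of_nonneg this]
  rcases lt_or_ge δ (hA.isHermitian.eigenvalues j) with h | h
  · simp [h, h.le, hδ, not_le.2 h]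
  · simp [h, this, not_lt.2 h]

lemma hermW_le_sum_max_min {N : ℕ} {A : Matrix (Fin N) (Fin N) ℂ} (hA : A.IsHermitian)
    (δ : ℝ) :
    hermW hA δ ≤
      ∑ j, max (min δ (hA.eigenvalues j)) 0 + ∑ j, max (min δ (-hA.eigenvalues j)) 0 := by
  rw [hermW, Finset.sum_filter, ← Finset.sum_add_distrib]
  refine Finset.sum_le_sum fun j _ => ?_
  split_ifs with h
  · rw [min_eq_right ((le_abs_self _).trans h), min_eq_right ((neg_le_abs _).trans h)]
    rcases abs_cases (hA.eigenvalues j) with ⟨h', -⟩ | ⟨h', -⟩ <;> rw [h']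
    · exact (le_max_left _ _).trans (le_add_of_nonneg_right (le_max_right _ _))
    · exact (le_max_left _ _).trans (le_add_of_nonneg_left (le_max_right _ _))
  · positivity

theorem w_sub_le {N : ℕ} (ρ σ : Matrix (Fin N) (Fin N) ℂ)
    (hρ : ρ.PosSemidef) (hσ : σ.PosSemidef) (δ : ℝ) (hδ : 0 ≤ δ) :
    hermW (hρ.isHermitian.sub hσ.isHermitian) δ
      ≤ (hermRank hρ.isHermitian δ : ℝ) * δ + (hermRank hσ.isHermitian δ : ℝ) * δ
        + hermW hρ.isHermitian δ + hermW hσ.isHermitian δ := by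
  have hA := hρ.isHermitian.sub hσ.isHermitian
  have hform : ∀ x : EuclideanSpace ℂ (Fin N),
      ∑ j, hA.eigenvalues j * ‖inner ℂ (hA.eigenvectorBasis j) x‖ ^ 2 =
        (inner ℂ x (ρ.toEuclideanLin x)).re - (inner ℂ x (σ.toEuclideanLin x)).re := fun x => by
    rw [← hA.re_inner_toEuclideanLin_eq_sum, map_sub, LinearMap.sub_apply, inner_sub_right,
      Complex.sub_re]
  have hpos := sum_max_min_le_of_card_filter_lt_le _ _
    (card_filter_lt_le_of_sum_mul_norm_inner_le hA.eigenvectorBasis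
      hρ.isHermitian.eigenvectorBasis hA.eigenvalues hρ.isHermitian.eigenvalues fun x => by
        rw [hform, ← hρ.isHermitian.re_inner_toEuclideanLin_eq_sum]
        linarith [hσ.re_inner_toEuclideanLin_nonneg x]) δ
  have hneg := sum_max_min_le_of_card_filter_lt_le _ _
    (card_filter_lt_le_of_sum_mul_norm_inner_le hA.eigenvectorBasis
      hσ.isHermitian.eigenvectorBasis (fun j => -hA.eigenvalues j)
      hσ.isHermitian.eigenvalues fun x => by
        simp only [neg_mul, Finset.sum_neg_distrib]
        rw [hform, ← hσ.isHermitian.re_inner_toEuclideanLin_eq_sum]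
        linarith [hρ.re_inner_toEuclideanLin_nonneg x]) δ
  rw [sum_max_min_eigenvalues_eq hρ hδ] at hpos
  rw [sum_max_min_eigenvalues_eq hσ hδ] at hneg
  linarith [hermW_le_sum_max_min hA δ]
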